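/- arXiv:0707.1313 — 5 statements merged into one kernel-verified Lean document; each statement's English description precedes it below -/
import Mathlib

section
/- Let X be a Polish space and let A be an analytic subset of the countable product X^ℕ (with the product topology). Then exactly one of the following holds: (a) there is a Borel map c : X → ℕ such that for every sequence (x_i)_{i∈ℕ} ∈ A the values c(x_i) are not all equal; (b) there is a continuous map u : 𝔾 → X such that for every sequence (γ_i)_{i∈ℕ} ∈ 𝔸_ω with γ_i ∈ 𝔾 for every i, the sequence (u(γ_i))_{i∈ℕ} belongs to A. -/
open Set

/-- Concatenation `s ⌢ γ` of a finite sequence with an infinite sequence. -/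
def cat {α : Type*} (s : List α) (γ : ℕ → α) : ℕ → α :=
  fun k => if h : k < s.length then s.get ⟨k, h⟩ else γ (k - s.length)

/-- The finite sequence `t` is an initial segment of the infinite sequence `f`. -/
def IsPrefixFun {α : Type*} (t : List α) (f : ℕ → α) : Prop :=
  ∀ k, (h : k < t.length) → f k = t.get ⟨k, h⟩

/-- The set `𝔸_ω ⊆ (ω^ω)^ω` associated with the dense sequence `s`. -/
def Aomega (s : ℕ → List ℕ) : Set (ℕ → ℕ → ℕ) :=
  {x | ∃ n γ, ∀ i, x i = cat (s n ++ [i]) γ}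

/-- The set `𝔾 ⊆ ω^ω` associated with the dense sequence `s`. -/
def Gset (s : ℕ → List ℕ) : Set (ℕ → ℕ) :=
  {α | ∀ m, ∃ n ≥ m, IsPrefixFun (s n ++ [0]) α}

/-- The functions agreeing with `h` at all the codes `Nat.pair j m < n`, where
`h` codes the sequence of functions `m ↦ h (Nat.pair j m)`. -/
def codedCylinder (h : ℕ → ℕ) (n j : ℕ) : Set (ℕ → ℕ) :=
  {α | ∀ m, Nat.pair j m < n → α m = h (Nat.pair j m)}

theorem mem_codedCylinder_update {h α : ℕ → ℕ} {j j' m v : ℕ}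
    (hα : α ∈ codedCylinder h (Nat.pair j m) j') (hv : j' = j → α m = v) :
    α ∈ codedCylinder (Function.update h (Nat.pair j m) v) (Nat.pair j m + 1) j' := by
  intro m' hm'
  by_cases heq : Nat.pair j' m' = Nat.pair j m
  · obtain ⟨rfl, rfl⟩ := Nat.pair_eq_pair.1 heq
    rw [Function.update_self]
    exact hv rfl
  · rw [Function.update_of_ne heq]
    exact hα m' (by omega)

theorem exists_initial_segment_subset {U : Set (ℕ → ℕ)} (hU : IsOpen U) {x : ℕ → ℕ} (hx : x ∈ U) :
    ∃ N, ∀ y : ℕ → ℕ, (∀ m < N, y m = x m) → y ∈ U := by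
  obtain ⟨_, ⟨z, N, rfl⟩, hxz, hz⟩ :=
    (PiNat.isTopologicalBasis_cylinders (fun _ => ℕ)).exists_subset_of_mem_open hx hU
  refine ⟨N, fun y hy => hz ?_⟩
  rw [← PiNat.mem_cylinder_iff_eq.1 hxz]
  exact hy

/-- The pieces of the images of `f` and `g` coded by the first `n` values of `h`
are separated by a product of measurable sets. -/
def CodedSeparable {X : Type*} [MeasurableSpace X] (f : (ℕ → ℕ) → X) (g : (ℕ → ℕ) → ℕ → X)
    (h : ℕ → ℕ) (n : ℕ) : Prop :=
  ∃ B : ℕ → Set X, (∀ i, MeasurableSet (B i)) ∧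
    (∀ i, ∀ α ∈ codedCylinder h n (i + 1), f α ∈ B i) ∧
    ∀ β ∈ codedCylinder h n 0, ∃ i, g β i ∉ B i

theorem CodedSeparable.of_forall_update {X : Type*} [MeasurableSpace X] {f : (ℕ → ℕ) → X}
    {g : (ℕ → ℕ) → ℕ → X} {h : ℕ → ℕ} {n : ℕ}
    (H : ∀ v, CodedSeparable f g (Function.update h n v) (n + 1)) : CodedSeparable f g h n := by
  obtain ⟨j, m, rfl⟩ : ∃ j m, n = Nat.pair j m := ⟨_, _, (Nat.pair_unpair n).symm⟩
  choose B hBm hBf hBg using H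
  cases j with
  | zero =>
    refine ⟨fun i => ⋂ v, B v i, fun i => .iInter fun v => hBm v i, fun i α hα => ?_,
      fun β hβ => ?_⟩
    · exact mem_iInter.2 fun v => hBf v i α (mem_codedCylinder_update hα (by simp))
    · obtain ⟨i, hi⟩ := hBg (β m) β (mem_codedCylinder_update hβ fun _ => rfl)
      exact ⟨i, fun hmem => hi (mem_iInter.1 hmem _)⟩
  | succ i₀ =>
    classical
    refine ⟨fun i => if i = i₀ then ⋃ v, B v i else ⋂ v, B v i, fun i => ?_, fun i α hα => ?_,
      fun β hβ => ?_⟩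
    · dsimp only
      split_ifs
      · exact .iUnion fun v => hBm v i
      · exact .iInter fun v => hBm v i
    · dsimp only
      split_ifs with hi
      · exact mem_iUnion.2 ⟨α m, hBf _ i α (mem_codedCylinder_update hα fun _ => rfl)⟩
      · exact mem_iInter.2 fun v => hBf v i α (mem_codedCylinder_update hα (by omega))
    · have key : ∀ v, ∃ i, g β i ∉ B v i := fun v =>
        hBg v β (mem_codedCylinder_update hβ (by simp))
      by_contra! hcon
      have h0 := hcon i₀
      rw [if_pos rfl] at h0
      obtain ⟨v, hv⟩ := mem_iUnion.1 h0
      obtain ⟨i, hi⟩ := key v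
      by_cases hii : i = i₀
      · exact hi (hii ▸ hv)
      · have h1 := hcon i
        rw [if_neg hii] at h1
        exact hi (mem_iInter.1 h1 v)

theorem codedSeparable_zero {X : Type*} [TopologicalSpace X] [T2Space X] [MeasurableSpace X]
    [OpensMeasurableSpace X] {f : (ℕ → ℕ) → X} {g : (ℕ → ℕ) → ℕ → X} (hf : Continuous f)
    (hg : Continuous g) (hfg : ∀ β, ∃ i, g β i ∉ range f) (h₀ : ℕ → ℕ) :
    CodedSeparable f g h₀ 0 := by
  by_contra hbad
  have step : ∀ n h, ¬ CodedSeparable f g h n →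
      ∃ v, ¬ CodedSeparable f g (Function.update h n v) (n + 1) := by
    intro n h hn
    by_contra! hall
    exact hn (.of_forall_update hall)
  choose! v hv using step
  let hs : ℕ → ℕ → ℕ := fun n => Nat.rec h₀ (fun n h => Function.update h n (v n h)) n
  have hs_succ : ∀ n, hs (n + 1) = Function.update (hs n) n (v n (hs n)) := fun _ => rfl
  have hs_bad : ∀ n, ¬ CodedSeparable f g (hs n) n := by
    intro n
    induction n with
    | zero => exact hbad
    | succ n ih => exact hv n _ ih
  let H : ℕ → ℕ := fun k => hs (k + 1) k
  have hs_eq : ∀ n k, k < n → hs n k = H k := by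
    intro n
    induction n with
    | zero => intro k hk; omega
    | succ n ih =>
      intro k hk
      rcases Nat.lt_succ_iff_lt_or_eq.1 hk with hk | rfl
      · rw [hs_succ, Function.update_of_ne hk.ne, ih k hk]
      · rfl
  let a : ℕ → ℕ → ℕ := fun j m => H (Nat.pair j m)
  obtain ⟨i, hi⟩ := hfg (a 0)
  have hne : f (a (i + 1)) ≠ g (a 0) i := fun heq => hi ⟨_, heq⟩
  obtain ⟨U, V, hU, hV, hfU, hgV, hUV⟩ := t2_separation hne
  obtain ⟨N₁, hN₁⟩ := exists_initial_segment_subset (hU.preimage hf) (x := a (i + 1)) hfU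
  obtain ⟨N₂, hN₂⟩ := exists_initial_segment_subset
    (hV.preimage ((continuous_apply i).comp hg)) (x := a 0) hgV
  have hmem : ∀ n j N, Nat.pair j N ≤ n → ∀ α ∈ codedCylinder (hs n) n j,
      ∀ m < N, α m = a j m := by
    intro n j N hn α hα m hm
    have hlt : Nat.pair j m < n := (Nat.pair_lt_pair_right j hm).trans_le hn
    rw [hα m hlt, hs_eq n _ hlt]
  refine hs_bad (max (Nat.pair (i + 1) N₁) (Nat.pair 0 N₂)) ?_
  classical
  refine ⟨fun i' => if i' = i then U else univ, fun i' => ?_, fun i' α hα => ?_, fun β hβ => ?_⟩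
  · dsimp only
    split_ifs
    · exact hU.measurableSet
    · exact .univ
  · dsimp only
    split_ifs with hii
    · subst hii
      exact hN₁ α (hmem _ _ _ (le_max_left _ _) α hα)
    · trivial
  · refine ⟨i, ?_⟩
    dsimp only
    rw [if_pos rfl]
    intro hmemU
    exact disjoint_left.1 hUV hmemU (hN₂ β (hmem _ _ _ (le_max_right _ _) β hβ))

/-- An analytic set independent for an analytic `ℕ`-dimensional hypergraph is contained in a
measurable independent set. -/
theorem exists_measurableSet_independent_superset {X : Type*} [TopologicalSpace X] [T2Space X]
    [MeasurableSpace X] [OpensMeasurableSpace X] {A : Set (ℕ → X)}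
    (hA : MeasureTheory.AnalyticSet A) {S : Set X} (hS : MeasureTheory.AnalyticSet S)
    (hAS : ∀ x ∈ A, ∃ i, x i ∉ S) :
    ∃ B, S ⊆ B ∧ MeasurableSet B ∧ ∀ x ∈ A, ∃ i, x i ∉ B := by
  rw [MeasureTheory.AnalyticSet] at hA hS
  rcases hS with rfl | ⟨f, hf, rfl⟩
  · exact ⟨∅, subset_rfl, .empty, fun x _ => ⟨0, by simp⟩⟩
  rcases hA with rfl | ⟨g, hg, rfl⟩
  · exact ⟨univ, subset_univ _, .univ, by simp⟩
  obtain ⟨B, hBm, hBf, hBg⟩ := codedSeparable_zero hf hg (fun β => hAS _ ⟨β, rfl⟩) 0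
  refine ⟨⋂ i, B i, ?_, .iInter hBm, ?_⟩
  · rintro _ ⟨α, rfl⟩
    exact mem_iInter.2 fun i => hBf i α (by intro m hm; omega)
  · rintro _ ⟨β, rfl⟩
    obtain ⟨i, hi⟩ := hBg β (by intro m hm; omega)
    exact ⟨i, fun hmem => hi (mem_iInter.1 hmem i)⟩

theorem isPrefixFun_cat {α : Type*} (t : List α) (γ : ℕ → α) : IsPrefixFun t (cat t γ) := by
  intro k hk
  simp [cat, hk]

theorem cat_add_length {α : Type*} (t : List α) (γ : ℕ → α) (k : ℕ) :
    cat t γ (k + t.length) = γ k := by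
  simp [cat]

theorem IsPrefixFun.cat_shift_eq {α : Type*} {t : List α} {f : ℕ → α} (h : IsPrefixFun t f) :
    cat t (fun k => f (k + t.length)) = f := by
  funext k
  by_cases hk : k < t.length
  · rw [isPrefixFun_cat t _ k hk, h k hk]
  · simp [cat, hk, Nat.sub_add_cancel (not_lt.1 hk)]

theorem isPrefixFun_of_prefix {α : Type*} {t t' : List α} {f : ℕ → α} (htt' : t <+: t')
    (h : IsPrefixFun t' f) : IsPrefixFun t f := by
  intro k hk
  rw [h k (hk.trans_le htt'.length_le)]
  exact (htt'.getElem hk).symm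

theorem isOpen_setOf_isPrefixFun (t : List ℕ) : IsOpen {α : ℕ → ℕ | IsPrefixFun t α} := by
  have : {α : ℕ → ℕ | IsPrefixFun t α} =
      ⋂ k : Fin t.length, (fun α : ℕ → ℕ => α k) ⁻¹' {t.get k} := by
    ext α
    simp only [mem_iInter, mem_preimage, mem_singleton_iff]
    exact ⟨fun h k => h k k.2, fun h k hk => h ⟨k, hk⟩⟩
  rw [this]
  exact isOpen_iInter_of_finite fun k => (isOpen_discrete _).preimage (continuous_apply _)

theorem continuous_cat (t : List ℕ) : Continuous (cat t) := by
  refine continuous_pi fun k => ?_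
  by_cases hk : k < t.length
  · simpa [cat, hk] using continuous_const
  · simpa [cat, hk] using continuous_apply _

theorem isOpenMap_cat (t : List ℕ) : IsOpenMap (cat t) := by
  intro U hU
  have : cat t '' U = {α | IsPrefixFun t α} ∩ (fun α k => α (k + t.length)) ⁻¹' U := by
    ext α
    constructor
    · rintro ⟨γ, hγ, rfl⟩
      refine ⟨isPrefixFun_cat t γ, ?_⟩
      simpa only [mem_preimage, cat_add_length] using hγ
    · rintro ⟨hα, hU⟩
      exact ⟨_, hU, hα.cat_shift_eq⟩
  rw [this]
  exact (isOpen_setOf_isPrefixFun t).inter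
    (hU.preimage (continuous_pi fun k => continuous_apply _))

theorem exists_isPrefixFun_subset {U : Set (ℕ → ℕ)} (hU : IsOpen U) (hne : U.Nonempty) :
    ∃ t : List ℕ, ∀ α, IsPrefixFun t α → α ∈ U := by
  obtain ⟨x, hx⟩ := hne
  obtain ⟨N, hN⟩ := exists_initial_segment_subset hU hx
  refine ⟨List.ofFn fun k : Fin N => x k, fun α hα => hN α fun m hm => ?_⟩
  simpa using hα m (by simpa using hm)

theorem Gset_mem_residual {s : ℕ → List ℕ} (hlen : ∀ n, (s n).length = n)
    (hdense : ∀ t : List ℕ, ∃ n, t <+: s n) : Gset s ∈ residual (ℕ → ℕ) := by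
  have hG : Gset s = ⋂ m, ⋃ n ≥ m, {α | IsPrefixFun (s n ++ [0]) α} := by
    ext α
    simp [Gset]
  rw [hG, countable_iInter_mem]
  refine fun m => residual_of_dense_open
    (isOpen_biUnion fun n _ => isOpen_setOf_isPrefixFun _) ?_
  refine dense_iff_inter_open.2 fun U hU hne => ?_
  obtain ⟨t, ht⟩ := exists_isPrefixFun_subset hU hne
  obtain ⟨n, hn⟩ := hdense (t ++ List.replicate m 0)
  have hmn : m ≤ n := by
    have := hn.length_le
    simp only [List.length_append, List.length_replicate, hlen] at this
    omega
  refine ⟨cat (s n ++ [0]) 0, ht _ ?_, mem_biUnion hmn (isPrefixFun_cat _ _)⟩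
  exact isPrefixFun_of_prefix (((List.prefix_append _ _).trans hn).trans (List.prefix_append _ _))
    (isPrefixFun_cat _ _)

open Topology in
/-- Every Borel map from `Gset s` to `ℕ` is constant on some sequence of `Aomega s`. -/
theorem exists_mem_Aomega_forall_eq {s : ℕ → List ℕ} (hlen : ∀ n, (s n).length = n)
    (hdense : ∀ t : List ℕ, ∃ n, t <+: s n) {c : Gset s → ℕ} (hc : Measurable c) :
    ∃ γ : ℕ → Gset s, (fun i => (γ i : ℕ → ℕ)) ∈ Aomega s ∧ ∀ i j, c (γ i) = c (γ j) := by
  have hG := Gset_mem_residual hlen hdense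
  have hGm : MeasurableSet (Gset s) := by
    have : Gset s = ⋂ m, ⋃ n, ⋃ _ : n ≥ m, {α | IsPrefixFun (s n ++ [0]) α} := by
      ext α
      simp [Gset]
    rw [this]
    exact .iInter fun m => .iUnion fun n => .iUnion fun _ =>
      (isOpen_setOf_isPrefixFun _).measurableSet
  let C : ℕ → Set (ℕ → ℕ) := fun m => Subtype.val '' (c ⁻¹' {m})
  have hC : ∀ m, MeasurableSet (C m) := fun m =>
    hGm.subtype_image (hc (measurableSet_singleton m))
  choose U hU hCU using fun m => (hC m).baireMeasurableSet.residualEq_isOpen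
  obtain ⟨m, hm⟩ : ∃ m, (U m).Nonempty := by
    by_contra! hempty
    have hall : ∀ᶠ α in residual (ℕ → ℕ), ∀ m, (α ∈ C m ↔ α ∈ U m) :=
      eventually_countable_forall.2 fun m => (hCU m).mem_iff
    obtain ⟨α, hα, hαG⟩ := (dense_of_mem_residual (hall.and hG)).nonempty
    have := (hα (c ⟨α, hαG⟩)).1 ⟨⟨α, hαG⟩, rfl, rfl⟩
    rw [hempty] at this
    exact this
  obtain ⟨t, ht⟩ := exists_isPrefixFun_subset (hU m) hm
  obtain ⟨n, hn⟩ := hdense t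
  have hres : ∀ᶠ γ in residual (ℕ → ℕ), ∀ i, cat (s n ++ [i]) γ ∈ C m := by
    refine eventually_countable_forall.2 fun i => ?_
    have h1 := (tendsto_residual_of_isOpenMap (continuous_cat (s n ++ [i]))
      (isOpenMap_cat _)).eventually (hCU m).mem_iff
    filter_upwards [h1] with γ hγ
    exact hγ.2 (ht _ (isPrefixFun_of_prefix (hn.trans (List.prefix_append _ _))
      (isPrefixFun_cat _ _)))
  obtain ⟨γ, hγ⟩ := (dense_of_mem_residual hres).nonempty
  choose δ hδ hδ' using hγ
  refine ⟨δ, ⟨n, γ, hδ'⟩, fun i j => ?_⟩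
  exact (hδ i).trans (hδ j).symm

/-- The initial segment of length `n` of `α`, listed backwards. -/
def revPrefix {α : Type*} (f : ℕ → α) : ℕ → List α
  | 0 => []
  | n + 1 => f n :: revPrefix f n

theorem revPrefix_length {α : Type*} (f : ℕ → α) (n : ℕ) : (revPrefix f n).length = n := by
  induction n with
  | zero => rfl
  | succ n ih => simp [revPrefix, ih]

theorem revPrefix_congr {α : Type*} {f g : ℕ → α} {n : ℕ} (h : ∀ k < n, f k = g k) :
    revPrefix f n = revPrefix g n := by
  induction n with
  | zero => rfl
  | succ n ih =>
    rw [revPrefix, revPrefix, h n n.lt_succ_self, ih fun k hk => h k (hk.trans n.lt_succ_self)]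

theorem IsPrefixFun.revPrefix_eq {α : Type*} {t : List α} {f : ℕ → α} (h : IsPrefixFun t f) :
    revPrefix f t.length = t.reverse := by
  induction t using List.reverseRecOn with
  | nil => rfl
  | append_singleton t a ih =>
    have ha : f t.length = a := by simpa using h t.length (by simp)
    rw [List.length_append, List.length_singleton, revPrefix, ha,
      ih (isPrefixFun_of_prefix (List.prefix_append _ _) h)]
    simp

theorem revPrefix_cat {α : Type*} (t : List α) (γ : ℕ → α) (m : ℕ) :
    revPrefix (cat t γ) (t.length + m) = revPrefix γ m ++ t.reverse := by
  induction m with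
  | zero => exact (isPrefixFun_cat t γ).revPrefix_eq
  | succ m ih =>
    rw [← Nat.add_assoc, revPrefix, ih, Nat.add_comm, cat_add_length]
    rfl

/-- A labelling of vertices by points of `X`, and of hyperedges by points of
`E`. The hyperedge with labels `k, t` consists of the vertices `s k ⌢ i ⌢ t`; finite sequences
are listed backwards. -/
abbrev Labelling (X E : Type*) := (List ℕ → X) × (ℕ → List ℕ → E)

/-- The restriction of a labelling to the sequences ending with `i`. -/
def Labelling.slice {X E : Type*} (i : ℕ) (w : Labelling X E) : Labelling X E :=
  (fun t => w.1 (i :: t), fun k t => w.2 k (i :: t))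

/-- The labellings obtained by joining members of `P` along one hyperedge, labelled `n`. -/
def amplify {X E : Type*} (φ : E → ℕ → X) (r : List ℕ) (n : ℕ) (P : Set (Labelling X E)) :
    Set (Labelling X E) :=
  {w | (∀ i, w.slice i ∈ P) ∧ ∀ i, φ (w.2 n []) i = w.1 (i :: r)}

/-- The labellings in `P` cannot all be made to meet, at level `n`, a countable union of
measurable `A`-independent sets. -/
def IsPositive {X E : Type*} [MeasurableSpace X] (A : Set (ℕ → X)) (n : ℕ)
    (P : Set (Labelling X E)) : Prop :=
  ∀ 𝓑 : Set (Set X), 𝓑.Countable → (∀ B ∈ 𝓑, MeasurableSet B ∧ ∀ x ∈ A, ∃ i, x i ∉ B) →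
    ∃ w ∈ P, ∀ t : List ℕ, t.length = n → w.1 t ∉ ⋃₀ 𝓑

theorem IsPositive.nonempty {X E : Type*} [MeasurableSpace X] {A : Set (ℕ → X)} {n : ℕ}
    {P : Set (Labelling X E)} (hP : IsPositive A n P) : P.Nonempty := by
  obtain ⟨w, hw, -⟩ := hP ∅ countable_empty (by simp)
  exact ⟨w, hw⟩

theorem IsPositive.exists_inter {X E ι : Type*} [MeasurableSpace X] [Countable ι]
    {A : Set (ℕ → X)} {n : ℕ} {P : Set (Labelling X E)} (hP : IsPositive A n P)
    {K : ι → Set (Labelling X E)} (hK : ∀ w, ∃ j, w ∈ K j) : ∃ j, IsPositive A n (P ∩ K j) := by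
  by_contra! hcon
  simp only [IsPositive] at hcon
  push Not at hcon
  choose 𝓑 hc hB hmeet using hcon
  obtain ⟨w, hw, hwt⟩ := hP (⋃ j, 𝓑 j) (countable_iUnion hc) (by
    intro B hmem
    obtain ⟨j, hj⟩ := mem_iUnion.1 hmem
    exact hB j B hj)
  obtain ⟨j, hj⟩ := hK w
  obtain ⟨t, ht, B, hBj, htB⟩ := hmeet j w ⟨hw, hj⟩
  exact hwt t ht ⟨B, mem_iUnion.2 ⟨j, hBj⟩, htB⟩

theorem Labelling.continuous_slice {X E : Type*} [TopologicalSpace X] [TopologicalSpace E] (i : ℕ) :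
    Continuous (Labelling.slice (X := X) (E := E) i) := by
  unfold Labelling.slice
  fun_prop

theorem isClosed_amplify {X E : Type*} [TopologicalSpace X] [T2Space X] [TopologicalSpace E]
    {φ : E → ℕ → X} (hφ : Continuous φ) (r : List ℕ) (n : ℕ) {P : Set (Labelling X E)}
    (hP : IsClosed P) : IsClosed (amplify φ r n P) := by
  have : amplify φ r n P = (⋂ i, Labelling.slice i ⁻¹' P) ∩
      ⋂ i, {w : Labelling X E | φ (w.2 n []) i = w.1 (i :: r)} := by
    ext w
    simp [amplify]
  rw [this]
  refine (isClosed_iInter fun i => hP.preimage (Labelling.continuous_slice i)).inter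
    (isClosed_iInter fun i => isClosed_eq ?_ (by fun_prop))
  exact (continuous_apply i).comp (hφ.comp (by fun_prop))

theorem IsPositive.amplify {X E : Type*} [TopologicalSpace X] [PolishSpace X] [MeasurableSpace X]
    [BorelSpace X] [TopologicalSpace E] [PolishSpace E] {φ : E → ℕ → X} (hφ : Continuous φ)
    {r : List ℕ} {n : ℕ} (hr : r.length = n) {P : Set (Labelling X E)} (hPc : IsClosed P)
    (hP : IsPositive (range φ) n P) : IsPositive (range φ) (n + 1) (amplify φ r n P) := by
  intro 𝓑 h𝓑c h𝓑
  by_contra! hcon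
  let P' : Set (Labelling X E) := P ∩ ⋂ t : {t : List ℕ // t.length = n}, {w | w.1 t ∉ ⋃₀ 𝓑}
  have h𝓑m : MeasurableSet (⋃₀ 𝓑) := .sUnion h𝓑c fun B hB => (h𝓑 B hB).1
  have hP' : MeasureTheory.AnalyticSet P' := by
    borelize (Labelling X E)
    refine (hPc.measurableSet.inter (.iInter fun t => ?_)).analyticSet
    have hcont : Continuous fun w : Labelling X E => w.1 t := by fun_prop
    exact hcont.measurable h𝓑m.compl
  have hcont : Continuous fun w : Labelling X E => w.1 r := by fun_prop
  obtain ⟨B, hSB, hBm, hB⟩ := exists_measurableSet_independent_superset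
    (MeasureTheory.analyticSet_range_of_polishSpace hφ) (hP'.image_of_continuous hcont) (by
      rintro _ ⟨b, rfl⟩
      by_contra! hall
      choose w hwP hw using hall
      let w' : Labelling X E := (fun t => t.casesOn (φ b 0) fun i t => (w i).1 t,
        fun k t => t.casesOn b fun i t => (w i).2 k t)
      obtain ⟨t, ht, htB⟩ := hcon w' ⟨fun i => (hwP i).1, fun i => (hw i).symm⟩
      obtain ⟨i, t, rfl⟩ := List.exists_cons_of_length_eq_add_one ht
      exact mem_iInter.1 (hwP i).2 ⟨t, by simpa using ht⟩ htB)
  obtain ⟨w, hwP, hw⟩ := hP (insert B 𝓑) (h𝓑c.insert B) (by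
    rintro B' (rfl | hB')
    exacts [⟨hBm, hB⟩, h𝓑 _ hB'])
  rw [sUnion_insert] at hw
  by_cases hwP' : w ∈ P'
  · exact hw r hr (Or.inl (hSB ⟨w, hwP', rfl⟩))
  · refine hwP' ⟨hwP, mem_iInter.2 fun t => ?_⟩
    exact fun hmem => hw t t.2 (Or.inr hmem)

/-- A positive closed set refines to one on which the labels of the vertex `s n ⌢ 0` and of the
hyperedges with labels `k, t` containing it, `k ≤ n`, are determined up to `ε`. -/
theorem IsPositive.exists_refinement {X E : Type*} [MetricSpace X] [SecondCountableTopology X]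
    [MeasurableSpace X] [MetricSpace E] [SecondCountableTopology E] {A : Set (ℕ → X)} {m : ℕ}
    {P : Set (Labelling X E)} (hP : IsPositive A m P) (hPc : IsClosed P) (v : List ℕ) (n : ℕ)
    {ε : ℝ} (hε : 0 < ε) :
    ∃ Q ⊆ P, IsClosed Q ∧ IsPositive A m Q ∧
      (∀ w ∈ Q, ∀ w' ∈ Q, dist (w.1 v) (w'.1 v) ≤ ε) ∧
      ∀ k ≤ n, ∀ w ∈ Q, ∀ w' ∈ Q,
        dist (w.2 k (v.take (n - k))) (w'.2 k (v.take (n - k))) ≤ ε := by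
  obtain ⟨w₀, -⟩ := hP.nonempty
  have : Nonempty X := ⟨w₀.1 []⟩
  have : Nonempty E := ⟨w₀.2 0 []⟩
  let K : ℕ × (Fin (n + 1) → ℕ) → Set (Labelling X E) := fun j =>
    {w | dist (w.1 v) (TopologicalSpace.denseSeq X j.1) ≤ ε / 2} ∩
      ⋂ k : Fin (n + 1),
        {w | dist (w.2 k (v.take (n - k))) (TopologicalSpace.denseSeq E (j.2 k)) ≤ ε / 2}
  have hK : ∀ w, ∃ j, w ∈ K j := by
    intro w
    obtain ⟨a, ha⟩ := (TopologicalSpace.denseRange_denseSeq X).exists_dist_lt (w.1 v) (half_pos hε)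
    choose b hb using fun k : Fin (n + 1) =>
      (TopologicalSpace.denseRange_denseSeq E).exists_dist_lt (w.2 k (v.take (n - k)))
        (half_pos hε)
    exact ⟨(a, b), ha.le, mem_iInter.2 fun k => (hb k).le⟩
  obtain ⟨j, hj⟩ := hP.exists_inter hK
  have hKc : IsClosed (K j) :=
    (isClosed_le (by fun_prop) continuous_const).inter
      (isClosed_iInter fun k => isClosed_le (by fun_prop) continuous_const)
  refine ⟨P ∩ K j, inter_subset_left, hPc.inter hKc, hj, ?_, ?_⟩
  · intro w hw w' hw'
    exact (dist_triangle_right _ _ _).trans ((add_le_add hw.2.1 hw'.2.1).trans_eq (add_halves ε))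
  · intro k hk w hw w' hw'
    have h1 := mem_iInter.1 hw.2.2 ⟨k, Nat.lt_succ_of_le hk⟩
    have h2 := mem_iInter.1 hw'.2.2 ⟨k, Nat.lt_succ_of_le hk⟩
    exact (dist_triangle_right _ _ _).trans ((add_le_add h1 h2).trans_eq (add_halves ε))

/-- A decreasing sequence of nonempty sets of arbitrarily small diameter in a complete space
converges to a point. -/
theorem exists_mem_closure_tendsto_of_antitone {M : Type*} [MetricSpace M] [CompleteSpace M]
    {D : ℕ → Set M} (hD : Antitone D) (hne : ∀ n, (D n).Nonempty)
    (hsmall : ∀ ε > 0, ∃ n, ∀ a ∈ D n, ∀ b ∈ D n, dist a b ≤ ε) :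
    ∃ x, (∀ n, x ∈ closure (D n)) ∧
      ∀ k, ∀ y : ℕ → M, (∀ n, y n ∈ D (k + n)) → Filter.Tendsto y Filter.atTop (nhds x) := by
  choose y hy using hne
  have hcauchy : CauchySeq y := by
    refine Metric.cauchySeq_iff'.2 fun ε hε => ?_
    obtain ⟨N, hN⟩ := hsmall (ε / 2) (half_pos hε)
    exact ⟨N, fun n hn => (hN _ (hD hn (hy n)) _ (hy N)).trans_lt (half_lt_self hε)⟩
  obtain ⟨x, hx⟩ := cauchySeq_tendsto_of_complete hcauchy
  have hcl : ∀ n, x ∈ closure (D n) := fun n => mem_closure_of_tendsto hx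
    (Filter.eventually_atTop.2 ⟨n, fun m hm => hD hm (hy m)⟩)
  refine ⟨x, hcl, fun k z hz => Metric.tendsto_atTop.2 fun ε hε => ?_⟩
  obtain ⟨N, hN⟩ := hsmall (ε / 2) (half_pos hε)
  refine ⟨N, fun n hn => ?_⟩
  have hsub : closure (D N) ⊆ Metric.closedBall (z n) (ε / 2) :=
    closure_minimal (fun a ha => hN a ha _ (hD (hn.trans (Nat.le_add_left n k)) (hz n)))
      Metric.isClosed_closedBall
  have := hsub (hcl N)
  rw [Metric.mem_closedBall, dist_comm] at this
  linarith

theorem exists_continuous_of_isPositive_univ {X E : Type*} [MetricSpace X] [CompleteSpace X]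
    [SecondCountableTopology X] [MeasurableSpace X] [BorelSpace X] [MetricSpace E]
    [CompleteSpace E] [SecondCountableTopology E] {φ : E → ℕ → X} (hφ : Continuous φ)
    {s : ℕ → List ℕ} (hlen : ∀ n, (s n).length = n)
    (h0 : IsPositive (range φ) 0 (univ : Set (Labelling X E))) :
    ∃ u : Gset s → X, Continuous u ∧
      ∀ γ : ℕ → Gset s, (fun i => (γ i : ℕ → ℕ)) ∈ Aomega s → (fun i => u (γ i)) ∈ range φ := by
  have step : ∀ n (P : {P : Set (Labelling X E) // IsClosed P ∧ IsPositive (range φ) n P}),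
      ∃ Q : {Q : Set (Labelling X E) // IsClosed Q ∧ IsPositive (range φ) (n + 1) Q},
        Q.1 ⊆ amplify φ (s n).reverse n P.1 ∧
        (∀ w ∈ Q.1, ∀ w' ∈ Q.1,
          dist (w.1 (0 :: (s n).reverse)) (w'.1 (0 :: (s n).reverse)) ≤ (1 / 2 : ℝ) ^ n) ∧
        ∀ k ≤ n, ∀ w ∈ Q.1, ∀ w' ∈ Q.1,
          dist (w.2 k ((0 :: (s n).reverse).take (n - k)))
            (w'.2 k ((0 :: (s n).reverse).take (n - k))) ≤ (1 / 2 : ℝ) ^ n := by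
    intro n P
    obtain ⟨Q, hQ, hQc, hQp, h1, h2⟩ :=
      (P.2.2.amplify hφ (r := (s n).reverse) (by simp [hlen]) P.2.1).exists_refinement
        (isClosed_amplify hφ _ _ P.2.1) (0 :: (s n).reverse) n
        (ε := (1 / 2 : ℝ) ^ n) (by positivity)
    exact ⟨⟨Q, hQc, hQp⟩, hQ, h1, h2⟩
  choose F hFsub hFv hFe using step
  let T : ∀ n, {P : Set (Labelling X E) // IsClosed P ∧ IsPositive (range φ) n P} := fun n =>
    Nat.rec ⟨univ, isClosed_univ, h0⟩ F n
  let P : ℕ → Set (Labelling X E) := fun n => (T n).1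
  have hP_ne : ∀ n, (P n).Nonempty := fun n => (T n).2.2.nonempty
  have hP_slice : ∀ n, ∀ w ∈ P (n + 1), ∀ i, w.slice i ∈ P n :=
    fun n w hw => (hFsub n (T n) hw).1
  have hP_edge : ∀ n, ∀ w ∈ P (n + 1), ∀ i, φ (w.2 n []) i = w.1 (i :: (s n).reverse) :=
    fun n w hw => (hFsub n (T n) hw).2
  have hP_config : ∀ k (t : List ℕ), ∀ w ∈ P (k + 1 + t.length), ∀ i,
      φ (w.2 k t) i = w.1 (t ++ i :: (s k).reverse) := by
    intro k t
    induction t with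
    | nil => exact fun w hw i => hP_edge k w hw i
    | cons j t ih => exact fun w hw i => ih (w.slice j) (hP_slice _ w hw j) i
  have hsmall_pow : ∀ ε > (0 : ℝ), ∃ N : ℕ, ∀ n ≥ N, (1 / 2 : ℝ) ^ n ≤ ε := by
    intro ε hε
    obtain ⟨N, hN⟩ := exists_pow_lt_of_lt_one hε (by norm_num : (1 / 2 : ℝ) < 1)
    exact ⟨N, fun n hn =>
      (pow_le_pow_of_le_one (by norm_num) (by norm_num) hn).trans hN.le⟩
  have hG : ∀ {α : ℕ → ℕ}, α ∈ Gset s → ∀ N, ∃ n ≥ N,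
      revPrefix α (n + 1) = 0 :: (s n).reverse := by
    intro α hα N
    obtain ⟨n, hn, hpre⟩ := hα N
    refine ⟨n, hn, ?_⟩
    simpa [hlen] using hpre.revPrefix_eq
  let D : (ℕ → ℕ) → ℕ → Set X := fun α n => (fun w => w.1 (revPrefix α n)) '' P n
  have hD_anti : ∀ α, Antitone (D α) := by
    refine fun α => antitone_nat_of_succ_le fun n => ?_
    rintro _ ⟨w, hw, rfl⟩
    exact ⟨w.slice (α n), hP_slice n w hw _, rfl⟩
  have hD_small : ∀ α ∈ Gset s, ∀ ε > 0, ∃ n, ∀ a ∈ D α n, ∀ b ∈ D α n, dist a b ≤ ε := by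
    intro α hα ε hε
    obtain ⟨N, hN⟩ := hsmall_pow ε hε
    obtain ⟨n, hn, hpre⟩ := hG hα N
    refine ⟨n + 1, ?_⟩
    rintro _ ⟨w, hw, rfl⟩ _ ⟨w', hw', rfl⟩
    dsimp only
    rw [hpre]
    exact (hFv n (T n) w hw w' hw').trans (hN n hn)
  choose u hu_cl hu_lim using fun α : Gset s => exists_mem_closure_tendsto_of_antitone
    (hD_anti α) (fun n => (hP_ne n).image _) (hD_small α α.2)
  refine ⟨u, ?_, ?_⟩
  · refine continuous_iff_continuousAt.2 fun α => Metric.tendsto_nhds.2 fun ε hε => ?_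
    obtain ⟨n, hn⟩ := hD_small α α.2 (ε / 2) (half_pos hε)
    have hopen : IsOpen {β : Gset s | IsPrefixFun (List.ofFn fun k : Fin n => α.1 k) β.1} :=
      (isOpen_setOf_isPrefixFun _).preimage continuous_subtype_val
    filter_upwards [hopen.mem_nhds (by intro k hk; simp)] with β hβ
    have hDβ : D β n = D α n := by
      have : revPrefix β.1 n = revPrefix α.1 n :=
        revPrefix_congr fun k hk => by simpa using hβ k (by simpa using hk)
      simp only [D, this]
    have hdist : ∀ a ∈ closure (D α n), ∀ b ∈ closure (D α n), dist a b ≤ ε / 2 := by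
      intro a ha b hb
      have hcl : IsClosed {p : X × X | dist p.1 p.2 ≤ ε / 2} :=
        isClosed_le continuous_dist continuous_const
      have hmem : (a, b) ∈ closure (D α n ×ˢ D α n) := by
        rw [closure_prod_eq]
        exact ⟨ha, hb⟩
      exact closure_minimal (fun p hp => hn p.1 hp.1 p.2 hp.2) hcl hmem
    exact (hdist _ (hDβ ▸ hu_cl β n) _ (hu_cl α n)).trans_lt (half_lt_self hε)
  · rintro δ ⟨k, γ, hδ⟩
    have hrev : ∀ i m, revPrefix (δ i).1 (k + 1 + m) =
        revPrefix γ m ++ i :: (s k).reverse := by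
      intro i m
      have := revPrefix_cat (s k ++ [i]) γ m
      rw [List.length_append, hlen, List.length_singleton, ← hδ i] at this
      simpa using this
    let De : ℕ → Set E := fun m => (fun w => w.2 k (revPrefix γ m)) '' P (k + 1 + m)
    have hDe_anti : Antitone De := by
      refine antitone_nat_of_succ_le fun m => ?_
      rintro _ ⟨w, hw, rfl⟩
      exact ⟨w.slice (γ m), hP_slice _ w hw _, rfl⟩
    have hDe_small : ∀ ε > 0, ∃ m, ∀ a ∈ De m, ∀ b ∈ De m, dist a b ≤ ε := by
      intro ε hε
      obtain ⟨N, hN⟩ := hsmall_pow ε hε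
      obtain ⟨n, hn, hpre⟩ := hG (δ 0).2 (max N k)
      obtain ⟨m, rfl⟩ := Nat.exists_eq_add_of_le ((le_max_right _ _).trans hn)
      have htake : (0 :: (s (k + m)).reverse).take (k + m - k) = revPrefix γ m := by
        rw [← hpre, Nat.add_right_comm, hrev, Nat.add_sub_cancel_left]
        exact List.take_left' (revPrefix_length γ m)
      refine ⟨m, ?_⟩
      rintro _ ⟨w, hw, rfl⟩ _ ⟨w', hw', rfl⟩
      rw [Nat.add_right_comm] at hw hw'
      have := hFe (k + m) (T (k + m)) k (Nat.le_add_right k m) w hw w' hw'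
      rw [htake] at this
      exact this.trans (hN _ ((le_max_left _ _).trans hn))
    choose w hw using fun m => hP_ne (k + 1 + m)
    obtain ⟨e, -, he⟩ := exists_mem_closure_tendsto_of_antitone hDe_anti
      (fun m => (hP_ne _).image _) hDe_small
    have hlim_e := he 0 (fun m => (w m).2 k (revPrefix γ m)) fun m => by
      rw [Nat.zero_add]
      exact ⟨w m, hw m, rfl⟩
    refine ⟨e, funext fun i => ?_⟩
    have h1 : Filter.Tendsto (fun m => φ ((w m).2 k (revPrefix γ m)) i) Filter.atTop
        (nhds (φ e i)) :=
      (((continuous_apply i).comp hφ).tendsto e).comp hlim_e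
    have h2 : Filter.Tendsto (fun m => (w m).1 (revPrefix (δ i).1 (k + 1 + m))) Filter.atTop
        (nhds (u (δ i))) :=
      hu_lim (δ i) (k + 1) _ fun m => ⟨w m, hw m, rfl⟩
    refine tendsto_nhds_unique h1 (h2.congr fun m => ?_)
    rw [hrev, hP_config k (revPrefix γ m) (w m) (by rw [revPrefix_length]; exact hw m) i]

theorem exists_measurable_coloring {X E : Type*} [MeasurableSpace X] [Nonempty E]
    {A : Set (ℕ → X)} (h : ¬ IsPositive A 0 (univ : Set (Labelling X E))) :
    ∃ c : X → ℕ, Measurable c ∧ ∀ x ∈ A, ¬ ∀ i j, c (x i) = c (x j) := by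
  simp only [IsPositive] at h
  push Not at h
  obtain ⟨𝓑, h𝓑c, h𝓑, hcover⟩ := h
  have hcov : ∀ x, x ∈ ⋃₀ 𝓑 := by
    intro x
    obtain ⟨t, -, ht⟩ := hcover (fun _ => x, fun _ _ => Classical.arbitrary E) trivial
    exact ht
  rcases 𝓑.eq_empty_or_nonempty with rfl | hne
  · have : IsEmpty X := ⟨fun x => by simpa using hcov x⟩
    exact ⟨fun _ => 0, measurable_const, fun x _ => isEmptyElim (x 0)⟩
  obtain ⟨B, rfl⟩ := h𝓑c.exists_eq_range hne
  have hB : ∀ n, MeasurableSet (B n) ∧ ∀ x ∈ A, ∃ i, x i ∉ B n := fun n => h𝓑 _ ⟨n, rfl⟩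
  have hex : ∀ x, ∃ n, x ∈ B n := fun x => by simpa using hcov x
  classical
  refine ⟨fun x => Nat.find (hex x), measurable_find hex fun n => (hB n).1, ?_⟩
  intro x hx hall
  obtain ⟨i, hi⟩ := (hB (Nat.find (hex (x 0)))).2 x hx
  apply hi
  have h1 : Nat.find (hex (x 0)) = Nat.find (hex (x i)) := hall 0 i
  rw [h1]
  exact Nat.find_spec (hex (x i))

theorem stmt0 (s : ℕ → List ℕ)
    (hlen : ∀ n, (s n).length = n)
    (hdense : ∀ t : List ℕ, ∃ n, t <+: s n)
    (X : Type*) [TopologicalSpace X] [PolishSpace X]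
    [MeasurableSpace X] [BorelSpace X]
    (A : Set (ℕ → X)) (hA : MeasureTheory.AnalyticSet A) :
    Xor'
      (∃ c : X → ℕ, Measurable c ∧ ∀ x ∈ A, ¬ ∀ i j, c (x i) = c (x j))
      (∃ u : ↥(Gset s) → X, Continuous u ∧
        ∀ γ : ℕ → ↥(Gset s), (fun i => (γ i : ℕ → ℕ)) ∈ Aomega s →
          (fun i => u (γ i)) ∈ A) := by
  refine (xor_iff_or_and_not_and _ _).2 ?_
  refine ⟨?_, ?_⟩
  · rw [MeasureTheory.AnalyticSet] at hA
    rcases hA with rfl | ⟨φ, hφ, rfl⟩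
    · exact Or.inl ⟨fun _ => 0, measurable_const, by simp⟩
    · let _ := TopologicalSpace.upgradeIsCompletelyMetrizable X
      let _ := TopologicalSpace.upgradeIsCompletelyMetrizable (ℕ → ℕ)
      by_cases h : IsPositive (range φ) 0 (univ : Set (Labelling X (ℕ → ℕ)))
      · exact Or.inr (exists_continuous_of_isPositive_univ hφ hlen h)
      · exact Or.inl (exists_measurable_coloring h)
  · rintro ⟨⟨c, hc, hcA⟩, u, hu, huA⟩
    obtain ⟨γ, hγ, hconst⟩ :=
      exists_mem_Aomega_forall_eq hlen hdense (hc.comp hu.measurable)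
    exact hcA _ (huA γ hγ) hconst
end

section
/- There is no continuous map u : ω^ω → ω^ω with range contained in 𝔾 such that for every sequence (γ_i)_{i∈ℕ} ∈ 𝔸_ω, the sequence (u(γ_i))_{i∈ℕ} belongs to 𝔸_ω. (In the paper's notation: [ω^ω, 𝔸_ω] ⋠_c [𝔾, 𝔸_ω ∩ 𝔾^ω].) -/
open Set

/-- Replacing the entry of `α` at `p` makes `u α` take the same new value at the coordinate `m`, and
changes no other coordinate of `u α`. -/
def Controls (u : (ℕ → ℕ) → (ℕ → ℕ)) (p : ℕ) (α : ℕ → ℕ) (m : ℕ) : Prop :=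
  (∀ i, u (Function.update α p i) m = i) ∧
    ∀ c, c ≠ m → ∀ i j, u (Function.update α p i) c = u (Function.update α p j) c

theorem cat_append_singleton_apply_length {α : Type*} (t : List α) (a : α) (γ : ℕ → α) :
    cat (t ++ [a]) γ t.length = a := by
  simp [cat]

theorem cat_append_singleton_apply_of_ne {α : Type*} (t : List α) (a b : α) (γ : ℕ → α) {c : ℕ}
    (hc : c ≠ t.length) : cat (t ++ [a]) γ c = cat (t ++ [b]) γ c := by
  rcases lt_or_gt_of_ne hc with h | h
  · have h' : c < t.length + 1 := by omega
    simp [cat, h, h', List.getElem_append_left]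
  · have h' : ¬ c < t.length + 1 := by omega
    simp [cat, h']

theorem update_eq_cat_replicate {p : ℕ} {α : ℕ → ℕ} (hα : ∀ n < p, α n = 0) (i : ℕ) :
    Function.update α p i = cat (List.replicate p 0 ++ [i]) (fun k => α (k + (p + 1))) := by
  funext n
  rcases lt_trichotomy n p with h | h | h
  · have h' : n < p + 1 := by omega
    simp [cat, h.ne, hα n h, h, h', List.getElem_append_left]
  · subst h
    simp [cat]
  · have h' : ¬ n < p + 1 := by omega
    have h'' : n - (p + 1) + (p + 1) = n := by omega
    simp [cat, h.ne', h', h'']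

theorem exists_controls {s : ℕ → List ℕ} (hlen : ∀ n, (s n).length = n)
    {u : (ℕ → ℕ) → (ℕ → ℕ)} (hu : ∀ γ ∈ Aomega s, (fun i => u (γ i)) ∈ Aomega s)
    {p : ℕ} (hp : s p = List.replicate p 0) {α : ℕ → ℕ} (hα : ∀ n < p, α n = 0) :
    ∃ m, Controls u p α m := by
  obtain ⟨m, δ, h⟩ := hu (fun i => Function.update α p i)
    ⟨p, _, fun i => by rw [hp]; exact update_eq_cat_replicate hα i⟩
  refine ⟨m, fun i => ?_, fun c hc i j => ?_⟩
  · have := cat_append_singleton_apply_length (s m) i δ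
    rw [hlen] at this
    exact (congrFun (h i) m).trans this
  · rw [show u (Function.update α p i) = _ from h i, show u (Function.update α p j) = _ from h j]
    exact cat_append_singleton_apply_of_ne _ _ _ _ (by rwa [hlen])

/-- A continuous map from the Baire space to `ℕ` is constant on a basic neighbourhood of `0`. -/
theorem exists_forall_vanishing_eq {f : (ℕ → ℕ) → ℕ} (hf : Continuous f) :
    ∃ N, ∀ β : ℕ → ℕ, (∀ n < N, β n = 0) → f β = f 0 := by
  by_contra! h
  choose β hβ hne using h
  have hlim : Filter.Tendsto β Filter.atTop (nhds 0) := by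
    rw [tendsto_pi_nhds]
    intro c
    refine tendsto_const_nhds.congr' ?_
    filter_upwards [Filter.eventually_gt_atTop c] with N hN
    exact (hβ N c hN).symm
  have h := (hf.tendsto 0).comp hlim
  rw [nhds_discrete, Filter.tendsto_pure] at h
  obtain ⟨N, hN⟩ := h.exists
  exact hne N hN

theorem Controls.exists_forall_vanishing {s : ℕ → List ℕ} (hlen : ∀ n, (s n).length = n)
    {u : (ℕ → ℕ) → (ℕ → ℕ)} (hc : Continuous u)
    (hu : ∀ γ ∈ Aomega s, (fun i => u (γ i)) ∈ Aomega s)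
    {p m : ℕ} (hp : s p = List.replicate p 0) (hm : Controls u p 0 m) :
    ∃ N, ∀ β : ℕ → ℕ, (∀ n < N, β n = 0) → Controls u p β m := by
  have hcont : ∀ i, Continuous fun β : ℕ → ℕ => u (Function.update β p i) m := fun i =>
    (continuous_apply m).comp (hc.comp (continuous_id.update p continuous_const))
  obtain ⟨N₀, h₀⟩ := exists_forall_vanishing_eq (hcont 0)
  obtain ⟨N₁, h₁⟩ := exists_forall_vanishing_eq (hcont 1)
  refine ⟨N₀ + N₁ + p, fun β hβ => ?_⟩
  obtain ⟨m', hm'⟩ := exists_controls hlen hu hp (α := β) (fun n hn => hβ n (by omega))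
  have e₀ := h₀ β (fun n hn => hβ n (by omega))
  have e₁ := h₁ β (fun n hn => hβ n (by omega))
  simp only [hm.1] at e₀ e₁
  by_cases h : m = m'
  · exact h ▸ hm'
  · have := hm'.2 m h 0 1
    omega

theorem exists_lt_of_controls {u : (ℕ → ℕ) → (ℕ → ℕ)} (hc : Continuous u) (M : ℕ) :
    ∃ N, ∀ p ≥ N, ∀ m, Controls u p 0 m → M < m := by
  choose N hN using fun c => exists_forall_vanishing_eq ((continuous_apply c).comp hc)
  refine ⟨(Finset.range (M + 1)).sup N, fun p hp m hm => ?_⟩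
  by_contra! hle
  have hNp : N m ≤ p := (Finset.le_sup (Finset.mem_range.2 (by omega))).trans hp
  have h := hN m (Function.update 0 p 1) fun n hn => by
    rw [Function.update_of_ne (by omega)]; rfl
  have h₀ := hm.1 0
  rw [show Function.update (0 : ℕ → ℕ) p 0 = 0 from Function.update_eq_self p 0] at h₀
  have h₁ := hm.1 1
  simp only [Function.comp_apply] at h
  omega

theorem exists_controlled_sequence {s : ℕ → List ℕ} (hlen : ∀ n, (s n).length = n)
    (hzero : ∀ m, ∃ n ≥ m, s n = List.replicate n 0)
    {u : (ℕ → ℕ) → (ℕ → ℕ)} (hc : Continuous u)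
    (hu : ∀ γ ∈ Aomega s, (fun i => u (γ i)) ∈ Aomega s) :
    ∃ p m : ℕ → ℕ, StrictMono p ∧ StrictMono m ∧
      ∀ k, ∀ β : ℕ → ℕ, (∀ n < p (k + 1), β n = 0) → Controls u (p k) β (m k) := by
  let S := {q : ℕ × ℕ // s q.1 = List.replicate q.1 0 ∧ Controls u q.1 0 q.2}
  have mk : ∀ N, ∃ q : S, N ≤ q.1.1 := fun N => by
    obtain ⟨p, hN, hp⟩ := hzero N
    obtain ⟨m, hm⟩ := exists_controls hlen hu hp (α := 0) (fun _ _ => rfl)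
    exact ⟨⟨(p, m), hp, hm⟩, hN⟩
  have step : ∀ q : S, ∃ q' : S, q.1.1 < q'.1.1 ∧ q.1.2 < q'.1.2 ∧
      ∀ β : ℕ → ℕ, (∀ n < q'.1.1, β n = 0) → Controls u q.1.1 β q.1.2 := fun q => by
    obtain ⟨N₁, h₁⟩ := q.2.2.exists_forall_vanishing hlen hc hu q.2.1
    obtain ⟨N₂, h₂⟩ := exists_lt_of_controls hc q.1.2
    obtain ⟨q', hq'⟩ := mk (N₁ + N₂ + q.1.1 + 1)
    exact ⟨q', by omega, h₂ _ (by omega) _ q'.2.2,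
      fun β hβ => h₁ β fun n hn => hβ n (by omega)⟩
  choose next hp hm hctl using step
  obtain ⟨q₀, -⟩ := mk 0
  let q : ℕ → S := fun k => Nat.rec q₀ (fun _ => next) k
  exact ⟨fun k => (q k).1.1, fun k => (q k).1.2, strictMono_nat_of_lt_succ fun k => hp (q k),
    strictMono_nat_of_lt_succ fun k => hm (q k), fun k => hctl (q k)⟩

theorem exists_apply_eq_of_controls {u : (ℕ → ℕ) → (ℕ → ℕ)} {p m : ℕ → ℕ}
    (hp : StrictMono p) (hm : StrictMono m)
    (hctl : ∀ k, ∀ β : ℕ → ℕ, (∀ n < p (k + 1), β n = 0) → Controls u (p k) β (m k))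
    (i : ℕ → ℕ) : ∃ α, ∀ k, u α (m k) = i k := by
  let α : ℕ → ℕ → ℕ := fun K n => if n < p K then 0 else Function.extend p i 0 n
  have hα : ∀ K, Controls u (p K) (α (K + 1)) (m K) := fun K =>
    hctl K _ fun n hn => if_pos hn
  have hlt : ∀ K, p K < p (K + 1) := fun K => hp K.lt_succ_self
  have hupd : ∀ K, Function.update (α (K + 1)) (p K) (i K) = α K := fun K => by
    funext n
    have := hlt K
    rcases lt_trichotomy n (p K) with h | rfl | h
    · simp [α, h, h.ne, h.trans this]
    · simp [α, hp.injective.extend_apply]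
    · rw [Function.update_of_ne h.ne']
      by_cases h' : n < p (K + 1)
      · have hn : ¬ ∃ k, p k = n := by
          rintro ⟨k, rfl⟩
          rw [hp.lt_iff_lt] at h h'
          omega
        simp [α, h', h.not_gt, Function.extend_apply' _ _ _ hn]
      · simp [α, h', h.not_gt]
  have hupd₀ : ∀ K, Function.update (α (K + 1)) (p K) 0 = α (K + 1) := fun K => by
    rw [Function.update_eq_self_iff]
    exact (if_pos (hlt K)).symm
  have hsucc : ∀ K c, c ≠ m K → u (α K) c = u (α (K + 1)) c := fun K c hc => by
    have := (hα K).2 c hc (i K) 0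
    rwa [hupd, hupd₀] at this
  refine ⟨α 0, fun k => ?_⟩
  have key : ∀ K ≤ k, u (α 0) (m k) = u (α K) (m k) := fun K => by
    induction K with
    | zero => exact fun _ => rfl
    | succ K ih =>
      intro hK
      rw [ih (by omega), hsucc K _ (hm.injective.ne (by omega))]
  rw [key k le_rfl, ← hupd k]
  exact (hα k).1 (i k)

theorem StrictMono.exists_lt_le_succ {m : ℕ → ℕ} (hm : StrictMono m) {n : ℕ} (hn : m 0 < n) :
    ∃ k, m k < n ∧ n ≤ m (k + 1) := by
  by_contra! h
  have : ∀ k, m k < n := fun k => by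
    induction k with
    | zero => exact hn
    | succ k ih => exact h k ih
  exact absurd (hm.le_apply (x := n)) (this n).not_ge

theorem stmt4 (s : ℕ → List ℕ)
    (hlen : ∀ n, (s n).length = n)
    (hdense : ∀ t : List ℕ, ∃ n, t <+: s n)
    (hzero : ∀ m, ∃ n ≥ m, s n = List.replicate n 0) :
    ¬ ∃ u : (ℕ → ℕ) → (ℕ → ℕ), Continuous u ∧ (∀ α, u α ∈ Gset s) ∧
        ∀ γ ∈ Aomega s, (fun i => u (γ i)) ∈ Aomega s := by
  rintro ⟨u, hc, hG, hu⟩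
  obtain ⟨p, m, hp, hm, hctl⟩ := exists_controlled_sequence hlen hzero hc hu
  choose i hi using fun k => Infinite.exists_notMem_finset
    ((Finset.range (m (k + 1) + 1)).image fun n => (s n).getD (m k) 0)
  obtain ⟨α, hα⟩ := exists_apply_eq_of_controls hp hm hctl i
  obtain ⟨n, hn, hpre⟩ := hG α (m 0 + 1)
  obtain ⟨k, hk, hk'⟩ := hm.exists_lt_le_succ (n := n) (by omega)
  refine hi k (Finset.mem_image.2 ⟨n, Finset.mem_range.2 (by omega), ?_⟩)
  have hlt : m k < (s n).length := by rwa [hlen]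
  have h := hpre (m k) (by simp; omega)
  rw [hα] at h
  simp [h, hlt, List.getElem_append_left]
end

section
/- Let G be a dense G_δ subset of ω^ω. Then there is no Baire-measurable map u : G → ℕ (G with the subspace topology) such that for every sequence (γ_i)_{i∈ℕ} ∈ 𝔸_ω with γ_i ∈ G for every i, the values u(γ_i) are not all equal. (In the paper's notation: [G, 𝔸_ω ∩ G^ω] ⋠_Bm [ω, ¬Δ^ω(ω)].) -/
open Set

/-- A set has the Baire property if it differs from an open set by a meager set. -/
def HasBaireProperty {α : Type*} [TopologicalSpace α] (S : Set α) : Prop :=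
  ∃ U : Set α, IsOpen U ∧ IsMeagre (symmDiff S U)

/-- A map is Baire-measurable if preimages of open sets have the Baire property. -/
def BaireMeasurableFun {α β : Type*} [TopologicalSpace α] [TopologicalSpace β]
    (f : α → β) : Prop :=
  ∀ U : Set β, IsOpen U → HasBaireProperty (f ⁻¹' U)

theorem continuous_cat_s7 {α : Type*} [TopologicalSpace α] (s : List α) :
    Continuous (cat s : (ℕ → α) → ℕ → α) := by
  refine continuous_pi fun k => ?_
  unfold cat
  split_ifs
  · exact continuous_const
  · exact continuous_apply _

theorem cat_apply_of_lt {α : Type*} (s : List α) (γ : ℕ → α) {k : ℕ} (h : k < s.length) :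
    cat s γ k = s[k] := by
  simp [cat, h]

theorem cat_apply_add_length {α : Type*} (s : List α) (γ : ℕ → α) (k : ℕ) :
    cat s γ (k + s.length) = γ k := by
  simp [cat]

theorem image_cat {α : Type*} (s : List α) (x : ℕ → α) (V : Set (ℕ → α)) :
    cat s '' V = PiNat.cylinder (E := fun _ => α) (cat s x) s.length ∩
      (fun δ k => δ (k + s.length)) ⁻¹' V := by
  ext δ
  constructor
  · rintro ⟨γ, hγ, rfl⟩
    refine ⟨fun k hk => by rw [cat_apply_of_lt s γ hk, cat_apply_of_lt s x hk], ?_⟩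
    simpa only [mem_preimage, cat_apply_add_length] using hγ
  · rintro ⟨hcyl, hV⟩
    refine ⟨_, hV, funext fun k => ?_⟩
    by_cases hk : k < s.length
    · rw [cat_apply_of_lt s _ hk, hcyl k hk, cat_apply_of_lt s x hk]
    · obtain ⟨j, rfl⟩ := Nat.exists_eq_add_of_le' (not_lt.1 hk)
      rw [cat_apply_add_length]

theorem isOpenMap_cat_s7 {α : Type*} [TopologicalSpace α] [DiscreteTopology α] (s : List α) :
    IsOpenMap (cat s : (ℕ → α) → ℕ → α) := by
  intro V hV
  rcases V.eq_empty_or_nonempty with rfl | ⟨x, -⟩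
  · simp
  rw [image_cat s x]
  exact (PiNat.isOpen_cylinder _ _ _).inter
    (hV.preimage (continuous_pi fun k => continuous_apply (k + s.length)))

/-- A nonempty open set contains the cylinder of some member of a dense sequence. -/
theorem exists_cat_mem_of_isOpen {α ι : Type*} [TopologicalSpace α] [DiscreteTopology α]
    {s : ι → List α} (hdense : ∀ t : List α, ∃ n, t <+: s n) {U : Set (ℕ → α)} (hU : IsOpen U)
    (hne : U.Nonempty) : ∃ n, ∀ l γ, cat (s n ++ l) γ ∈ U := by
  obtain ⟨x, hx⟩ := hne
  obtain ⟨_, ⟨y, m, rfl⟩, -, hyU⟩ :=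
    (PiNat.isTopologicalBasis_cylinders fun _ : ℕ => α).exists_subset_of_mem_open hx hU
  obtain ⟨n, r, hr⟩ := hdense (List.ofFn fun i : Fin m => y i)
  refine ⟨n, fun l γ => hyU fun k hk => ?_⟩
  rw [← hr, cat_apply_of_lt _ _ (by simp; omega)]
  simp [hk]

/-- A Baire-measurable map from a nonmeagre subspace to a countable discrete space is constant on
a relatively comeagre part of some open set meeting the subspace. -/
theorem BaireMeasurableFun.exists_isOpen_isMeagre_diff {X β : Type*} [TopologicalSpace X]
    [TopologicalSpace β] [DiscreteTopology β] [Countable β] {G : Set X} (hG : ¬ IsMeagre G)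
    {u : G → β} (hu : BaireMeasurableFun u) :
    ∃ b, ∃ U : Set X, IsOpen U ∧ (U ∩ G).Nonempty ∧
      IsMeagre ((U ∩ G) \ Subtype.val '' (u ⁻¹' {b})) := by
  by_contra! hcon
  refine hG ?_
  have hfib : ∀ b, IsMeagre (Subtype.val '' (u ⁻¹' {b})) := by
    intro b
    obtain ⟨W, hW, hm⟩ := hu {b} (isOpen_discrete _)
    obtain ⟨U, hU, rfl⟩ := isOpen_induced_iff.1 hW
    by_cases hne : (U ∩ G).Nonempty
    · refine absurd (hm.image_val.mono ?_) (hcon b U hU hne)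
      rintro x ⟨⟨hxU, hxG⟩, hx⟩
      exact ⟨⟨x, hxG⟩, Or.inr ⟨hxU, fun h => hx ⟨_, h, rfl⟩⟩, rfl⟩
    · refine hm.image_val.mono ?_
      rintro _ ⟨x, hx, rfl⟩
      exact ⟨x, Or.inl ⟨hx, fun hxU => hne ⟨x, hxU, x.2⟩⟩, rfl⟩
  refine (isMeagre_iUnion hfib).mono fun x hx => ?_
  rw [mem_iUnion]
  exact ⟨u ⟨x, hx⟩, ⟨x, hx⟩, rfl, rfl⟩

theorem stmt7 (s : ℕ → List ℕ)
    (hlen : ∀ n, (s n).length = n)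
    (hdense : ∀ t : List ℕ, ∃ n, t <+: s n)
    (G : Set (ℕ → ℕ)) (hGdense : Dense G) (hGδ : IsGδ G) :
    ¬ ∃ u : ↥G → ℕ, BaireMeasurableFun u ∧
        ∀ γ : ℕ → ↥G, (fun i => (γ i : ℕ → ℕ)) ∈ Aomega s →
          ¬ ∀ i j, u (γ i) = u (γ j) := by
  rintro ⟨u, hu, hA⟩
  obtain ⟨b, U, hU, hne, hm⟩ :=
    hu.exists_isOpen_isMeagre_diff (not_isMeagre_of_isGδ_of_dense hGδ hGdense)
  obtain ⟨n, hn⟩ := exists_cat_mem_of_isOpen hdense hU hne.left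
  have hGc : IsMeagre Gᶜ := by
    simpa [IsMeagre] using residual_of_dense_Gδ hGδ hGdense
  have hbad := isMeagre_iUnion fun i => (hGc.union hm).preimage_of_isOpenMap
    (continuous_cat_s7 (s n ++ [i])) (isOpenMap_cat_s7 (s n ++ [i]))
  obtain ⟨γ, hγ⟩ := (dense_of_mem_residual hbad).nonempty
  have hgood : ∀ i, ∃ x : G, u x = b ∧ (x : ℕ → ℕ) = cat (s n ++ [i]) γ := by
    intro i
    by_contra hx
    refine hγ (mem_iUnion.2 ⟨i, ?_⟩)
    by_cases hG : cat (s n ++ [i]) γ ∈ G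
    · exact Or.inr ⟨⟨hn _ _, hG⟩, hx⟩
    · exact Or.inl hG
  choose x hxb hxγ using hgood
  exact hA x ⟨n, γ, hxγ⟩ fun i j => (hxb i).trans (hxb j).symm
end

section
/- For every l ∈ ℕ, the graph G_{l+1} on the set ω^{l+1} of length-(l+1) sequences of natural numbers is connected and acyclic (i.e., it is a tree). -/
open Set

/-- The oriented graph relation: `a = sₙ ⌢ 0 ⌢ t` and `b = sₙ ⌢ i ⌢ t` with `i ≠ 0`. -/
def seqRel (s : ℕ → List ℕ) (l : ℕ)
    (a b : {t : List ℕ // t.length = l + 1}) : Prop :=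
  ∃ n i t, i ≠ 0 ∧ a.val = s n ++ 0 :: t ∧ b.val = s n ++ i :: t

/-- The graph `G_{l+1}` on `ω^{l+1}`, the symmetrization of the oriented graph. -/
def seqGraph (s : ℕ → List ℕ) (l : ℕ) :
    SimpleGraph {t : List ℕ // t.length = l + 1} :=
  SimpleGraph.fromRel (seqRel s l)

/-- Appending a fixed last letter embeds `G_{l+1}` into `G_{l+2}`. -/
def seqGraphSnoc (s : ℕ → List ℕ) (l k : ℕ) : seqGraph s l →g seqGraph s (l + 1) where
  toFun a := ⟨a.val ++ [k], by simp [a.2]⟩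
  map_rel' := by
    have hrel : ∀ {a b}, seqRel s l a b →
        seqRel s (l + 1) ⟨a.val ++ [k], by simp [a.2]⟩ ⟨b.val ++ [k], by simp [b.2]⟩ := by
      rintro a b ⟨n, i, t, hi, ha, hb⟩
      exact ⟨n, i, t ++ [k], hi, by simp [ha], by simp [hb]⟩
    rintro a b ⟨hne, h⟩
    refine ⟨fun h' => hne (Subtype.ext ?_), h.imp hrel hrel⟩
    simpa using congrArg Subtype.val h'

/-- If words with a common last letter are joined in `G_{l+1}`, then `G_{l+1}` is preconnected:
the word `s l` links the different last letters. -/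
theorem seqGraph_preconnected_of_snoc {s : ℕ → List ℕ} (hlen : ∀ n, (s n).length = n) {l : ℕ}
    (h : ∀ (y z : List ℕ) (hy : y.length = l) (hz : z.length = l) (k : ℕ),
      (seqGraph s l).Reachable ⟨y ++ [k], by simp [hy]⟩ ⟨z ++ [k], by simp [hz]⟩) :
    (seqGraph s l).Preconnected := by
  have hroot : ∀ x, (seqGraph s l).Reachable x ⟨s l ++ [0], by simp [hlen]⟩ := by
    rintro ⟨x, hx⟩
    obtain ⟨y, k, rfl⟩ : ∃ y k, x = y ++ [k] :=
      ⟨_, _, (List.dropLast_append_getLast (List.ne_nil_of_length_eq_add_one hx)).symm⟩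
    refine (h y (s l) (by simpa using hx) (hlen l) k).trans ?_
    rcases eq_or_ne k 0 with rfl | hk
    · exact .rfl
    · exact SimpleGraph.Adj.reachable ⟨by simpa using hk, .inr ⟨l, k, [], hk, rfl, rfl⟩⟩
  exact fun x y => (hroot x).trans (hroot y).symm

theorem seqGraph_preconnected {s : ℕ → List ℕ} (hlen : ∀ n, (s n).length = n) (l : ℕ) :
    (seqGraph s l).Preconnected := by
  induction l with
  | zero =>
    refine seqGraph_preconnected_of_snoc hlen fun y z hy hz k => ?_
    obtain rfl := List.length_eq_zero_iff.mp hy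
    obtain rfl := List.length_eq_zero_iff.mp hz
    exact .rfl
  | succ l ih =>
    exact seqGraph_preconnected_of_snoc hlen fun y z hy hz k =>
      (ih ⟨y, hy⟩ ⟨z, hz⟩).map (seqGraphSnoc s l k)

/-- For each edge there is a set of words which separates its endpoints and is crossed by no other
edge between words of the same length. -/
theorem exists_separating_set (s : ℕ → List ℕ) (n i : ℕ)
    (hi : i ≠ 0) (t : List ℕ) :
    ∃ S : Set (List ℕ), s n ++ 0 :: t ∉ S ∧ s n ++ i :: t ∈ S ∧
      ∀ m j u, m + u.length = n + t.length →
        (s m ++ 0 :: u ∈ S ↔ s m ++ j :: u ∈ S) ∨ (m = n ∧ j = i ∧ u = t) := by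
  induction t using List.reverseRecOn with
  | nil =>
    refine ⟨{x | x.getLast? = some i}, by simp [hi.symm], by simp, fun m j u hu => ?_⟩
    rcases List.eq_nil_or_concat' u with rfl | ⟨u, k, rfl⟩
    · by_cases hj : j = i
      · exact .inr ⟨by simpa using hu, hj, rfl⟩
      · exact .inl (by simp [hi.symm, hj])
    · exact .inl (by simp [List.getLast?_append, List.getLast?_cons])
  | append_singleton t k ih =>
    obtain ⟨S, h0, h1, hS⟩ := ih
    have hsnoc : ∀ m j (u : List ℕ) k, s m ++ j :: (u ++ [k]) = (s m ++ j :: u) ++ [k] := by simp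
    refine ⟨{x | if x.getLast? = some k then x.dropLast ∈ S else s (n + t.length + 1) ∈ S},
      ?_, ?_, fun m j u hu => ?_⟩
    · rw [hsnoc]; simpa only [mem_ofPred_eq, List.getLast?_concat, List.dropLast_concat, if_true]
    · rw [hsnoc]; simpa only [mem_ofPred_eq, List.getLast?_concat, List.dropLast_concat, if_true]
    rcases List.eq_nil_or_concat' u with rfl | ⟨u, k', rfl⟩
    · obtain rfl : m = n + t.length + 1 := by simpa [add_assoc] using hu
      simp
    · rw [hsnoc, hsnoc]
      simp only [mem_ofPred_eq, List.getLast?_concat, List.dropLast_concat, Option.some.injEq]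
      by_cases hk : k' = k
      · subst hk
        simpa using hS m j u (by simpa [← add_assoc] using hu)
      · simp [hk]

theorem seqGraph_isBridge_of_seqRel {s : ℕ → List ℕ} (hlen : ∀ n, (s n).length = n) {l : ℕ}
    {a b : {t : List ℕ // t.length = l + 1}} (hab : seqRel s l a b) :
    (seqGraph s l).IsBridge s(a, b) := by
  obtain ⟨n, i, t, hi, ha, hb⟩ := hab
  obtain ⟨S, h0, h1, hS⟩ := exists_separating_set s n i hi t
  have hrel : ∀ {x y}, seqRel s l x y → s(x, y) ≠ s(a, b) → (x.val ∈ S ↔ y.val ∈ S) := by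
    rintro x y ⟨m, j, u, -, hx, hy⟩ hne
    have hlx := x.2
    have hla := a.2
    simp only [hx, ha, List.length_append, hlen, List.length_cons] at hlx hla
    rcases hS m j u (by omega) with h | ⟨rfl, rfl, rfl⟩
    · rwa [hx, hy]
    · exact absurd (by rw [Subtype.ext (hx.trans ha.symm), Subtype.ext (hy.trans hb.symm)]) hne
  rw [SimpleGraph.isBridge_iff]
  rintro ⟨w⟩
  have hw : ∀ {x y}, ((seqGraph s l).deleteEdges {s(a, b)}).Walk x y →
      (x.val ∈ S ↔ y.val ∈ S) := by
    intro x y w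
    induction w with
    | nil => rfl
    | cons h _ ih =>
      rw [SimpleGraph.deleteEdges_adj] at h
      refine Iff.trans ?_ ih
      rcases h.1.2 with hr | hr
      · exact hrel hr h.2
      · exact (hrel hr (by simpa [Sym2.eq_swap] using h.2)).symm
  exact h0 (ha ▸ (hw w).mpr (hb ▸ h1))

theorem seqGraph_isAcyclic {s : ℕ → List ℕ} (hlen : ∀ n, (s n).length = n) (l : ℕ) :
    (seqGraph s l).IsAcyclic := by
  rw [SimpleGraph.isAcyclic_iff_forall_adj_isBridge]
  rintro a b ⟨-, h | h⟩
  · exact seqGraph_isBridge_of_seqRel hlen h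
  · exact Sym2.eq_swap ▸ seqGraph_isBridge_of_seqRel hlen h

theorem stmt10 (s : ℕ → List ℕ)
    (hlen : ∀ n, (s n).length = n)
    (hdense : ∀ t : List ℕ, ∃ n, t <+: s n) :
    ∀ l : ℕ, (seqGraph s l).Connected ∧ (seqGraph s l).IsAcyclic := by
  intro l
  have : Nonempty {t : List ℕ // t.length = l + 1} := ⟨⟨s (l + 1), hlen _⟩⟩
  exact ⟨⟨seqGraph_preconnected hlen l⟩, seqGraph_isAcyclic hlen l⟩
end

section
/- Let G be a nonempty subset of ω^ω which is invariant under E₀ and satisfies: for every α ∈ G and all l, m ∈ ℕ there is n ≥ m with s_n⌢l a prefix of α. Then for every β ∈ ω^ω there is a map u from the E₀-equivalence class [β]_{E₀} into G such that for every sequence (γ_i)_{i∈ℕ} ∈ 𝔸_ω with γ_i ∈ [β]_{E₀} for every i, the sequence (u(γ_i))_{i∈ℕ} belongs to 𝔸_ω (and each u(γ_i) ∈ G). (In the paper's notation: [[β]_{E₀}, 𝔸_ω ∩ ([β]_{E₀})^ω] ⪯ [G, 𝔸_ω ∩ G^ω].) -/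
open Set

/-- The equivalence relation `E₀`: eventual equality of sequences. -/
def E0 (α β : ℕ → ℕ) : Prop := ∃ m, ∀ n ≥ m, α n = β n

/-- The sequences which agree with `τ` from position `N` on. -/
def tailClass (N : ℕ) (τ : ℕ → ℕ) : Set (ℕ → ℕ) := {x | ∀ n ≥ N, x n = τ n}

/-- `f` maps `tailClass N τ` into `G`, and maps the elements of `Aomega s` which lie in
`tailClass N τ` and branch below `N` to elements of `Aomega s`. -/
def IsPartialHom (s : ℕ → List ℕ) (G : Set (ℕ → ℕ)) (N : ℕ) (τ : ℕ → ℕ)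
    (f : (ℕ → ℕ) → (ℕ → ℕ)) : Prop :=
  (∀ x ∈ tailClass N τ, f x ∈ G) ∧
    ∀ n < N, ∀ γ : ℕ → ℕ, (∀ i, cat (s n ++ [i]) γ ∈ tailClass N τ) →
      (fun i => f (cat (s n ++ [i]) γ)) ∈ Aomega s

theorem tailClass_mono {N M : ℕ} (h : N ≤ M) (τ : ℕ → ℕ) : tailClass N τ ⊆ tailClass M τ :=
  fun _ hx n hn => hx n (h.trans hn)

theorem tailClass_eq_of_mem {N : ℕ} {τ r : ℕ → ℕ} (h : r ∈ tailClass N τ) :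
    tailClass N r = tailClass N τ := by
  ext x
  exact forall₂_congr fun n hn => by rw [h n hn]

theorem mem_tailClass_update {N : ℕ} {τ x : ℕ → ℕ} (h : x ∈ tailClass (N + 1) τ) :
    x ∈ tailClass N (Function.update τ N (x N)) := by
  intro n hn
  rcases eq_or_ne n N with rfl | hne
  · simp
  · rw [Function.update_of_ne hne, h n (by omega)]

theorem cat_append_singleton_length {α : Type*} (t : List α) (i : α) (γ : ℕ → α) :
    cat (t ++ [i]) γ t.length = i := by
  simp [cat]

theorem cat_append_singleton_of_lt {α : Type*} (t : List α) (i : α) (γ : ℕ → α) {k : ℕ}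
    (h : t.length < k) : cat (t ++ [i]) γ k = γ (k - (t.length + 1)) := by
  have : ¬ k < t.length + 1 := by omega
  simp [cat, this]

theorem cat_append_singleton_tail {α : Type*} {t : List α} {l : α} {f : ℕ → α}
    (h : IsPrefixFun (t ++ [l]) f) (i : α) :
    cat (t ++ [i]) (fun k => f (t.length + 1 + k)) = Function.update f t.length i := by
  funext k
  rcases lt_trichotomy k t.length with hk | rfl | hk
  · have hk' : k < t.length + 1 := by omega
    have := h k (by simpa using hk')
    rw [Function.update_of_ne hk.ne, this]
    simp [cat, hk, hk']
  · rw [cat_append_singleton_length, Function.update_self]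
  · rw [cat_append_singleton_of_lt _ _ _ hk, Function.update_of_ne hk.ne']
    congr 1
    omega

theorem IsPartialHom.exists_extend {s : ℕ → List ℕ} (hlen : ∀ n, (s n).length = n)
    {G : Set (ℕ → ℕ)} (hinv : ∀ α ∈ G, ∀ β, E0 β α → β ∈ G)
    (hG : ∀ α ∈ G, ∀ l : ℕ, ∃ n, IsPrefixFun (s n ++ [l]) α) {N : ℕ}
    (hroot : ∀ τ, ∀ r ∈ tailClass N τ, ∀ α ∈ G, ∃ f, IsPartialHom s G N τ f ∧ f r = α)
    {τ : ℕ → ℕ} {f : (ℕ → ℕ) → (ℕ → ℕ)} (hf : IsPartialHom s G N τ f) :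
    ∃ g, IsPartialHom s G (N + 1) τ g ∧ ∀ x ∈ tailClass N τ, g x = f x := by
  set p : ℕ → ℕ → ℕ := fun i => cat (s N ++ [i]) (fun k => τ (N + 1 + k)) with hp
  have hself : ∀ i γ, cat (s N ++ [i]) γ N = i := fun i γ => by
    simpa only [hlen] using cat_append_singleton_length (s N) i γ
  have hlt : ∀ n i γ k, n < k → cat (s n ++ [i]) γ k = γ (k - (n + 1)) := fun n i γ k hk => by
    simpa only [hlen] using cat_append_singleton_of_lt (s n) i γ (k := k) (by rwa [hlen])
  have hpN : ∀ i, p i N = i := fun i => hself i _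
  have hpmem : ∀ i, p i ∈ tailClass (N + 1) τ := fun i k hk => by
    rw [hp]
    simp only
    rw [hlt _ _ _ _ hk]
    congr 1
    omega
  have hpmem' : ∀ i, p i ∈ tailClass N (Function.update τ N i) := fun i => by
    simpa only [hpN] using mem_tailClass_update (hpmem i)
  have hα : f (p (τ N)) ∈ G := hf.1 _ (by simpa using hpmem' (τ N))
  obtain ⟨m, hm⟩ := hG _ hα (τ N)
  have hmval : f (p (τ N)) m = τ N := by
    have := hm m (by simp [hlen])
    simpa [hlen] using this
  have hF : ∀ i, ∃ F, IsPartialHom s G N (Function.update τ N i) F ∧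
      F (p i) = Function.update (f (p (τ N))) m i ∧ (i = τ N → F = f) := by
    intro i
    by_cases hi : i = τ N
    · subst hi
      refine ⟨f, by simpa using hf, ?_, fun _ => rfl⟩
      rw [eq_comm, Function.update_eq_self_iff, hmval]
    · obtain ⟨F, hF, hFp⟩ := hroot _ _ (hpmem' i) (Function.update (f (p (τ N))) m i)
        (hinv _ hα _ ⟨m + 1, fun n hn => Function.update_of_ne (by omega) _ _⟩)
      exact ⟨F, hF, hFp, fun h => absurd h hi⟩
  choose F hFhom hFp hFf using hF
  refine ⟨fun x => F (x N) x, ⟨fun x hx => (hFhom _).1 _ (mem_tailClass_update hx), ?_⟩,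
    fun x hx => congrFun (hFf _ (hx N le_rfl)) x⟩
  intro n hn γ hγ
  rcases Nat.lt_succ_iff_lt_or_eq.mp hn with hnN | rfl
  · have hval : ∀ i, cat (s n ++ [i]) γ N = γ (N - (n + 1)) := fun i => hlt _ _ _ _ hnN
    simp only [hval]
    refine (hFhom _).2 n hnN γ fun i => ?_
    simpa only [hval] using mem_tailClass_update (hγ i)
  · have hγp : ∀ i, cat (s n ++ [i]) γ = p i := fun i => by
      have : γ = fun k => τ (n + 1 + k) := funext fun k => by
        rw [← hγ 0 (n + 1 + k) (by omega), hlt _ _ _ _ (by omega)]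
        congr 1
        omega
      rw [this]
    refine ⟨m, fun k => f (p (τ n)) (m + 1 + k), fun i => ?_⟩
    simp only [hγp, hpN, hFp]
    simpa only [hlen] using (cat_append_singleton_tail hm i).symm

theorem exists_isPartialHom {s : ℕ → List ℕ} (hlen : ∀ n, (s n).length = n)
    {G : Set (ℕ → ℕ)} (hinv : ∀ α ∈ G, ∀ β, E0 β α → β ∈ G)
    (hG : ∀ α ∈ G, ∀ l : ℕ, ∃ n, IsPrefixFun (s n ++ [l]) α) (N : ℕ) :
    ∀ τ, ∀ r ∈ tailClass N τ, ∀ α ∈ G, ∃ f, IsPartialHom s G N τ f ∧ f r = α := by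
  induction N with
  | zero =>
    exact fun τ r _ α hα => ⟨fun _ => α, ⟨fun _ _ => hα, fun n hn => absurd hn n.not_lt_zero⟩, rfl⟩
  | succ N ih =>
    intro τ r hr α hα
    have hrr : r ∈ tailClass N r := fun _ _ => rfl
    obtain ⟨f, hf, hfr⟩ := ih r r hrr α hα
    obtain ⟨g, hg, hgf⟩ := hf.exists_extend hlen hinv hG ih
    refine ⟨g, ?_, (hgf r hrr).trans hfr⟩
    rwa [IsPartialHom, tailClass_eq_of_mem hr] at hg

theorem stmt11 (s : ℕ → List ℕ)
    (hlen : ∀ n, (s n).length = n)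
    (hdense : ∀ t : List ℕ, ∃ n, t <+: s n)
    (G : Set (ℕ → ℕ)) (hne : G.Nonempty)
    (hinv : ∀ α ∈ G, ∀ β, E0 β α → β ∈ G)
    (hG : ∀ α ∈ G, ∀ l m : ℕ, ∃ n ≥ m, IsPrefixFun (s n ++ [l]) α)
    (β : ℕ → ℕ) :
    ∃ u : {α : ℕ → ℕ // E0 α β} → (ℕ → ℕ),
      (∀ x, u x ∈ G) ∧
      ∀ γ : ℕ → {α : ℕ → ℕ // E0 α β},
        (fun i => (γ i : ℕ → ℕ)) ∈ Aomega s →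
          (fun i => u (γ i)) ∈ Aomega s := by
  have hG' : ∀ α ∈ G, ∀ l : ℕ, ∃ n, IsPrefixFun (s n ++ [l]) α := fun α hα l =>
    let ⟨n, _, hn⟩ := hG α hα l 0
    ⟨n, hn⟩
  have hroot := exists_isPartialHom hlen hinv hG'
  obtain ⟨α, hα⟩ := hne
  obtain ⟨f₀, hf₀, -⟩ := hroot 0 β β (fun _ _ => rfl) α hα
  choose! ext hext hext_eq using fun N f (hf : IsPartialHom s G N β f) =>
    hf.exists_extend hlen hinv hG' (hroot N)
  let f : ℕ → (ℕ → ℕ) → (ℕ → ℕ) := fun N => Nat.rec f₀ ext N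
  have hf : ∀ N, IsPartialHom s G N β (f N) := fun N => by
    induction N with
    | zero => exact hf₀
    | succ N ih => exact hext N _ ih
  have hmono : ∀ N M, N ≤ M → ∀ x ∈ tailClass N β, f M x = f N x := by
    intro N M hNM x hx
    induction M, hNM using Nat.le_induction with
    | base => rfl
    | succ M hNM ih => exact (hext_eq M _ (hf M) x (tailClass_mono hNM β hx)).trans ih
  choose rank hrank using fun x : {α : ℕ → ℕ // E0 α β} => x.2
  refine ⟨fun x => f (rank x) x, fun x => (hf _).1 _ (hrank x), ?_⟩
  rintro γ ⟨n, δ, hγ⟩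
  have hmem : ∀ i, (γ i : ℕ → ℕ) ∈ tailClass (max (rank (γ 0)) (n + 1)) β := by
    intro i k hk
    have hnk : (s n).length < k := by rw [hlen]; omega
    have h0 := hrank (γ 0) k (by omega)
    simp only [hγ] at h0 ⊢
    rwa [cat_append_singleton_of_lt _ _ _ hnk] at h0 ⊢
  have hu : ∀ i, f (rank (γ i)) (γ i) = f (max (rank (γ 0)) (n + 1)) (γ i) := fun i => by
    rcases le_total (rank (γ i)) (max (rank (γ 0)) (n + 1)) with h | h
    · exact (hmono _ _ h _ (hrank _)).symm
    · exact hmono _ _ h _ (hmem i)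
  simp only at hγ
  simp only [hu]
  simp only [hγ] at hmem ⊢
  exact (hf _).2 n (by omega) δ hmem
end
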